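/- Let W : X → pmfs on Y be a stochastic matrix on finite sets with C_0(W) ≠ C_1(W), and fix R_0, R_1 with C_0(W) < R_0 < R_1 < C_1(W). Then for all sufficiently large block lengths n, every rate-R code with feedback on the length-n stationary product channel built from W, with rate R satisfying R_0 + (2 ln n)/n^{1/3} < R < R_1, has average error probability P_e ≥ exp(−n·[E_sp(R − (2 ln n)/n^{1/3}, W) + (2 ln n)/n^{1/3}]). -/

import Mathlib

open Real MeasureTheory Filter

def IsPMF {Y : Type*} [Fintype Y] (W : Y → ℝ) : Prop :=
  (∀ y, 0 ≤ W y) ∧ ∑ y, W y = 1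

noncomputable def renyiDiv {Y : Type*} [Fintype Y] (α : ℝ) (W Q : Y → ℝ) : ℝ :=
  if α = 1 then ∑ y, W y * Real.log (W y / Q y)
  else (α - 1)⁻¹ * Real.log (∑ y, W y ^ α * Q y ^ (1 - α))

open Classical in
/-- Extended-real-valued order-`α` Rényi divergence, taking the value `⊤` when the
divergence is infinite. -/
noncomputable def renyiDivE {Y : Type*} [Fintype Y] (α : ℝ) (W Q : Y → ℝ) : ENNReal :=
  if α = 1 then
    (if ∀ y, Q y = 0 → W y = 0 then ENNReal.ofReal (renyiDiv 1 W Q) else ⊤)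
  else
    (if 0 < ∑ y, W y ^ α * Q y ^ (1 - α) then ENNReal.ofReal (renyiDiv α W Q) else ⊤)

/-- The order-`α` tilted pmf `W^α_Q`. -/
noncomputable def tilt {Y : Type*} [Fintype Y] (α : ℝ) (W Q : Y → ℝ) : Y → ℝ :=
  fun y => Real.exp ((1 - α) * renyiDiv α W Q) * W y ^ α * Q y ^ (1 - α)

/-- The order-`α` Rényi information `I_α(P;W)` (mutual information for `α = 1`). -/
noncomputable def renyiInfo {X Y : Type*} [Fintype X] [Fintype Y] (α : ℝ) (P : X → ℝ)
    (W : X → Y → ℝ) : ℝ :=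
  if α = 1 then ∑ x, P x * ∑ y, W x y * Real.log (W x y / (∑ x', P x' * W x' y))
  else (α / (α - 1)) * Real.log (∑ y, (∑ x, P x * W x y ^ α) ^ α⁻¹)

/-- The order-`α` Rényi capacity `C_α(W) = sup_P I_α(P;W)`. -/
noncomputable def renyiCap {X Y : Type*} [Fintype X] [Fintype Y] (α : ℝ) (W : X → Y → ℝ) : ℝ :=
  sSup {c | ∃ P : X → ℝ, IsPMF P ∧ c = renyiInfo α P W}

/-- The sphere packing exponent `E_sp(R,W)`. -/
noncomputable def spe {X Y : Type*} [Fintype X] [Fintype Y] (R : ℝ) (W : X → Y → ℝ) : ℝ :=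
  sSup {e | ∃ α ∈ Set.Ioo (0:ℝ) 1, e = ((1 - α) / α) * (renyiCap α W - R)}

/-- The order-`α` Rényi mean `q_{α,P}`. -/
noncomputable def renyiMean {X Y : Type*} [Fintype X] [Fintype Y] (α : ℝ) (P : X → ℝ)
    (W : X → Y → ℝ) : Y → ℝ :=
  fun y => (∑ x, P x * W x y ^ α) ^ α⁻¹ / ∑ y', (∑ x, P x * W x y' ^ α) ^ α⁻¹

/-- The probability that a length-`n` feedback code with encoder `enc` produces the
output sequence `y` when the message is `m`, on the stationary product channel built
from `W`.  The input at time `t` may depend on the message and on all previous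
outputs. -/
noncomputable def feedbackOutProb {X Y : Type*} [Fintype X] [Fintype Y] (W : X → Y → ℝ)
    {n M : ℕ} (enc : Fin M → ∀ t : Fin n, (Fin t → Y) → X)
    (m : Fin M) (y : Fin n → Y) : ℝ :=
  ∏ t, W (enc m t (fun s => y ⟨s.1, s.2.trans t.2⟩)) (y t)

/-- The average error probability of a feedback code `(enc, dec)` with equiprobable
messages. -/
noncomputable def feedbackAvgError {X Y : Type*} [Fintype X] [Fintype Y] (W : X → Y → ℝ)
    {n M : ℕ} (enc : Fin M → ∀ t : Fin n, (Fin t → Y) → X)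
    (dec : (Fin n → Y) → Fin M) : ℝ :=
  (1 / (M : ℝ)) * ∑ m, ∑ y ∈ Finset.univ.filter (fun y : Fin n → Y => dec y ≠ m),
    feedbackOutProb W enc m y

namespace SPF

set_option linter.unusedSectionVars false

/-- Sum over all lists of length `n`. -/
noncomputable def S {Y : Type*} [Fintype Y] (n : ℕ) (f : List Y → ℝ) : ℝ :=
  ∑ y : Fin n → Y, f (List.ofFn y)

/-- Path probability. -/
noncomputable def P {Y : Type*} : (List Y → Y → ℝ) → List Y → ℝ
  | _, [] => 1
  | w, a :: t => w [] a * P (fun h => w (a :: h)) t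

section basic
variable {Y : Type*} [Fintype Y]

lemma S_zero (f : List Y → ℝ) : S 0 f = f [] := by simp [S]

lemma S_succ (n : ℕ) (f : List Y → ℝ) : S (n+1) f = ∑ a, S n (fun t => f (a :: t)) := by
  unfold S
  rw [← (Fin.consEquiv (fun _ : Fin (n+1) => Y)).sum_comp, Fintype.sum_prod_type]
  simp [Fin.consEquiv]

lemma S_add (l n : ℕ) (f : List Y → ℝ) :
    S (l+n) f = S l (fun y => S n (fun z => f (y ++ z))) := by
  induction l generalizing f with
  | zero => simp [S_zero]
  | succ l ih =>
    rw [show l+1+n = (l+n)+1 by ring, S_succ, S_succ]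
    refine Finset.sum_congr rfl fun a _ => ?_
    rw [ih]; rfl

lemma S_mono {n : ℕ} {f g : List Y → ℝ} (h : ∀ y, y.length = n → f y ≤ g y) :
    S n f ≤ S n g := Finset.sum_le_sum fun y _ => h _ (by simp)

lemma S_congr {n : ℕ} {f g : List Y → ℝ} (h : ∀ y, y.length = n → f y = g y) :
    S n f = S n g := Finset.sum_congr rfl fun y _ => h _ (by simp)

lemma S_plus (n : ℕ) (f g : List Y → ℝ) : S n (fun y => f y + g y) = S n f + S n g :=
  Finset.sum_add_distrib

lemma S_sub (n : ℕ) (f g : List Y → ℝ) : S n (fun y => f y - g y) = S n f - S n g :=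
  Finset.sum_sub_distrib _ _

lemma S_mul (n : ℕ) (c : ℝ) (f : List Y → ℝ) : S n (fun y => c * f y) = c * S n f :=
  (Finset.mul_sum _ _ _).symm

lemma S_sum {ι : Type*} [Fintype ι] (n : ℕ) (f : ι → List Y → ℝ) :
    S n (fun y => ∑ j, f j y) = ∑ j, S n (f j) := Finset.sum_comm

lemma P_append (w : List Y → Y → ℝ) (y z : List Y) :
    P w (y ++ z) = P w y * P (fun h => w (y ++ h)) z := by
  induction y generalizing w with
  | nil => simp [P]
  | cons a t ih => simp [P, ih, mul_assoc]

lemma P_nonneg (w : List Y → Y → ℝ) (hw : ∀ h a, 0 ≤ w h a) (y : List Y) : 0 ≤ P w y := by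
  induction y generalizing w with
  | nil => simp [P]
  | cons a t ih => exact mul_nonneg (hw _ _) (ih _ fun h a => hw _ _)

lemma P_le_one (w : List Y → Y → ℝ) (hw : ∀ h a, 0 ≤ w h a) (hw1 : ∀ h a, w h a ≤ 1)
    (y : List Y) : P w y ≤ 1 := by
  induction y generalizing w with
  | nil => simp [P]
  | cons a t ih =>
    exact mul_le_one₀ (hw1 _ _) (P_nonneg _ (fun h b => hw _ _) _)
      (ih _ (fun h b => hw _ _) (fun h b => hw1 _ _))

lemma P_sum (w : List Y → Y → ℝ) (hw : ∀ h, ∑ a, w h a = 1) (n : ℕ) : S n (P w) = 1 := by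
  induction n generalizing w with
  | zero => simp [S_zero, P]
  | succ n ih =>
    rw [S_succ]
    simp only [P, S_mul]
    rw [← hw []]
    refine Finset.sum_congr rfl fun a _ => ?_
    have := ih (fun h => w (a :: h)) (fun h => hw _)
    rw [this, mul_one]

lemma P_ofFn {n : ℕ} (w : List Y → Y → ℝ) (y : Fin n → Y) :
    P w (List.ofFn y) = ∏ t : Fin n, w (List.ofFn (fun s : Fin t => y ⟨s.1, s.2.trans t.2⟩)) (y t) := by
  induction n generalizing w with
  | zero => simp [P]
  | succ n ih =>
    rw [List.ofFn_succ, P, Fin.prod_univ_succ, ih]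
    congr 1
    refine Finset.prod_congr rfl fun t _ => ?_
    congr 1
    simp only [Fin.val_succ]
    rw [List.ofFn_succ]
    rfl

/-- Gibbs. -/
lemma gibbs_pt {v q : ℝ} (hv : 0 ≤ v) (hq : 0 ≤ q) (h : 0 < v → 0 < q) :
    v - q ≤ v * Real.log (v / q) := by
  rcases hv.eq_or_lt with h0 | h0
  · subst h0; simpa using hq
  · have hq' := h h0
    have := Real.log_le_sub_one_of_pos (div_pos hq' h0)
    have e : Real.log (v / q) = - Real.log (q / v) := by
      rw [← Real.log_inv, inv_div]
    rw [e]
    have : v * Real.log (q/v) ≤ v * (q / v - 1) := mul_le_mul_of_nonneg_left this h0.le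
    have e2 : v * (q / v - 1) = q - v := by field_simp
    linarith

lemma exp_quad {x c : ℝ} (hx : |x| ≤ c) (hc : c ≤ 1) : Real.exp x ≤ 1 + x + c^2 := by
  have h1 := Real.abs_exp_sub_one_sub_id_le (x := x) (hx.trans hc)
  have h2 := (abs_le.1 h1).2
  have : x^2 ≤ c^2 := by rw [← sq_abs]; gcongr
  linarith

lemma mom_pt {v q θ c : ℝ} (hv : 0 ≤ v) (hθ : 0 ≤ θ)
    (h : 0 < v → 0 < q ∧ |Real.log (v / q)| ≤ c) (hc : θ * c ≤ 1) :
    v * (v / q) ^ θ ≤ v * (1 + (θ * c)^2) + θ * (v * Real.log (v / q)) := by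
  rcases hv.eq_or_lt with h0 | h0
  · subst h0; simp
  · obtain ⟨hq, hl⟩ := h h0
    have e : (v/q)^θ = Real.exp (θ * Real.log (v/q)) := by
      rw [Real.rpow_def_of_pos (div_pos h0 hq), mul_comm]
    have := exp_quad (x := θ * Real.log (v/q)) (c := θ * c)
      (by rw [abs_mul, abs_of_nonneg hθ]; gcongr) hc
    rw [e]
    have := mul_le_mul_of_nonneg_left this h0.le
    linarith

end basic

/-- Selection of mixture weights. -/
lemma select (K : ℕ) (hK : 0 < K) (f : ℕ → ℝ) (T Δ : ℝ) (hΔ : 0 ≤ Δ)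
    (hf : ∀ j, 0 ≤ f j) (hlast : f (K-1) ≤ T) :
    ∃ lam : Fin K → ℝ, (∀ j, 0 ≤ lam j) ∧ ∑ j, lam j = 1 ∧ ∑ j, lam j * f j ≤ T ∧
      ∑ j, lam j * (((j : ℕ) + 1) * Δ * (T - f j)) ≤ Δ * T := by
  classical
  by_cases h0 : f 0 ≤ T
  · refine ⟨fun j => if j = ⟨0, hK⟩ then 1 else 0, fun j => by positivity, by simp, by simpa using h0, ?_⟩
    simp
    have := mul_nonneg hΔ (hf 0)
    nlinarith
  · have hex : ∃ i, f i ≤ T := ⟨_, hlast⟩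
    set i := Nat.find hex with hi
    have hi1 : f i ≤ T := Nat.find_spec hex
    have hi0 : i ≠ 0 := by intro h; rw [h] at hi1; exact h0 hi1
    have hi2 : T < f (i-1) := by
      have := Nat.find_min hex (m := i-1) (by omega)
      linarith [not_le.1 this]
    have hiK : i ≤ K-1 := Nat.find_min' hex hlast
    obtain ⟨k, hk⟩ : ∃ k, i = k+1 := ⟨i-1, by omega⟩
    rw [hk] at hi1 hi2 hiK
    simp only [Nat.add_sub_cancel] at hi2
    have hd : 0 < f k - f (k+1) := by linarith
    set μ := (T - f (k+1)) / (f k - f (k+1)) with hμ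
    have hμ0 : 0 ≤ μ := div_nonneg (by linarith) hd.le
    have hμ1 : μ ≤ 1 := by rw [hμ, div_le_one hd]; linarith
    have hμe : μ * (f k - f (k+1)) = T - f (k+1) := by rw [hμ]; field_simp
    have hsum : ∀ g : ℕ → ℝ, ∑ j : Fin K, ((if (j:ℕ) = k then μ else 0) + (if (j:ℕ) = k+1 then 1-μ else 0)) * g j
        = μ * g k + (1-μ) * g (k+1) := by
      intro g
      rw [Fin.sum_univ_eq_sum_range (fun j => ((if j = k then μ else 0) + (if j = k+1 then 1-μ else 0)) * g j) K]
      simp only [add_mul, Finset.sum_add_distrib, ite_mul, zero_mul, Finset.sum_ite_eq', Finset.mem_range]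
      rw [if_pos (by omega), if_pos (by omega)]
    refine ⟨fun j => (if (j:ℕ) = k then μ else 0) + (if (j:ℕ) = k+1 then 1-μ else 0), ?_, ?_, ?_, ?_⟩
    · intro j
      have : 0 ≤ 1 - μ := by linarith
      positivity
    · have := hsum (fun _ => 1)
      simp only [mul_one] at this
      rw [this]; ring
    · rw [hsum f]; nlinarith
    · rw [hsum (fun j => ((j:ℝ)+1) * Δ * (T - f j))]
      push_cast
      have e : μ * (((k:ℝ) + 1) * Δ * (T - f k)) + (1 - μ) * (((k:ℝ) + 1 + 1) * Δ * (T - f (k + 1)))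
        = Δ * ((1-μ) * (T - f (k+1))) := by
        have : μ * (T - f k) = - ((1-μ) * (T - f (k+1))) := by linarith
        linear_combination ((k:ℝ)+1) * Δ * this
      rw [e]
      apply mul_le_mul_of_nonneg_left _ hΔ
      have := hf (k+1)
      nlinarith [mul_nonneg hμ0 (sub_nonneg.2 hi1)]

section letter
variable {X Y : Type*} [Fintype X] [Fintype Y] [Nonempty X] [Nonempty Y]

/-- The function minimised by the optimal input distribution. -/
noncomputable def phi (α : ℝ) (W : X → Y → ℝ) (p : X → ℝ) : ℝ :=
  ∑ y, (∑ x, p x * W x y ^ α) ^ α⁻¹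

lemma pmf_le_one {Z : Type*} [Fintype Z] {p : Z → ℝ} (hp : IsPMF p) (z : Z) : p z ≤ 1 := by
  rw [← hp.2]
  exact Finset.single_le_sum (fun i _ => hp.1 i) (Finset.mem_univ z)

lemma phi_lower (α : ℝ) (hα : α ∈ Set.Ioo (0:ℝ) 1) (W : X → Y → ℝ) (hW : ∀ x, IsPMF (W x))
    (p : X → ℝ) (hp : IsPMF p) : ((Fintype.card Y : ℝ)⁻¹) ^ α⁻¹ ≤ phi α W p := by
  have hs0 : ∀ y, 0 ≤ ∑ x, p x * W x y ^ α := fun y =>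
    Finset.sum_nonneg fun x _ => mul_nonneg (hp.1 x) (Real.rpow_nonneg ((hW x).1 y) _)
  have h1 : 1 ≤ ∑ y, ∑ x, p x * W x y ^ α := by
    rw [Finset.sum_comm]
    calc (1:ℝ) = ∑ x, p x * ∑ y, W x y := by simp [(hW _).2, hp.2]
      _ ≤ _ := by
        refine Finset.sum_le_sum fun x _ => ?_
        rw [Finset.mul_sum]
        refine Finset.sum_le_sum fun y _ => mul_le_mul_of_nonneg_left ?_ (hp.1 x)
        exact Real.self_le_rpow_of_le_one ((hW x).1 y) (pmf_le_one (hW x) y) hα.2.le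
  have hc : (0:ℝ) < Fintype.card Y := by exact_mod_cast Fintype.card_pos
  obtain ⟨y, hy⟩ : ∃ y, (Fintype.card Y : ℝ)⁻¹ ≤ ∑ x, p x * W x y ^ α := by
    by_contra hcon
    push Not at hcon
    have : ∑ y, ∑ x, p x * W x y ^ α < ∑ y : Y, (Fintype.card Y : ℝ)⁻¹ :=
      Finset.sum_lt_sum_of_nonempty Finset.univ_nonempty fun y _ => hcon y
    simp [hc.ne'] at this
    linarith
  calc _ ≤ (∑ x, p x * W x y ^ α) ^ α⁻¹ :=
        Real.rpow_le_rpow (by positivity) hy (inv_nonneg.2 hα.1.le)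
    _ ≤ _ := Finset.single_le_sum (f := fun y => (∑ x, p x * W x y ^ α) ^ α⁻¹)
        (fun y _ => Real.rpow_nonneg (hs0 y) _) (Finset.mem_univ y)

lemma phi_pos (α : ℝ) (hα : α ∈ Set.Ioo (0:ℝ) 1) (W : X → Y → ℝ) (hW : ∀ x, IsPMF (W x))
    (p : X → ℝ) (hp : IsPMF p) : 0 < phi α W p := by
  have hc : (0:ℝ) < Fintype.card Y := by exact_mod_cast Fintype.card_pos
  exact (by positivity : (0:ℝ) < ((Fintype.card Y : ℝ)⁻¹) ^ α⁻¹).trans_le (phi_lower α hα W hW p hp)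

lemma info_eq (α : ℝ) (hα : α ∈ Set.Ioo (0:ℝ) 1) (W : X → Y → ℝ) (p : X → ℝ) :
    (1-α) * renyiInfo α p W = - (α * Real.log (phi α W p)) := by
  have h1 : α - 1 ≠ 0 := by linarith [hα.2]
  rw [renyiInfo, if_neg hα.2.ne, phi]
  field_simp
  ring

lemma exists_opt (α : ℝ) (hα : α ∈ Set.Ioo (0:ℝ) 1) (W : X → Y → ℝ) :
    ∃ p, IsPMF p ∧ ∀ p', IsPMF p' → phi α W p ≤ phi α W p' := by
  classical
  have hK : IsCompact (stdSimplex ℝ X) := isCompact_stdSimplex ℝ X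
  obtain ⟨x⟩ := ‹Nonempty X›
  have hcont : Continuous (phi α W) := by
    unfold phi
    refine continuous_finsetSum _ fun y _ => ?_
    refine Continuous.rpow_const ?_ (fun _ => Or.inr (inv_nonneg.2 hα.1.le))
    fun_prop
  obtain ⟨p, hp, hmin⟩ := hK.exists_isMinOn ⟨_, single_mem_stdSimplex ℝ x⟩ hcont.continuousOn
  exact ⟨p, ⟨hp.1, hp.2⟩, fun p' hp' => hmin (show p' ∈ stdSimplex ℝ X from ⟨hp'.1, hp'.2⟩)⟩

lemma cap_bdd (α : ℝ) (hα : α ∈ Set.Ioo (0:ℝ) 1) (W : X → Y → ℝ) (hW : ∀ x, IsPMF (W x)) :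
    ∀ p, IsPMF p → renyiInfo α p W ≤ Real.log (Fintype.card Y) / (1-α) := by
  intro p hp
  have h1 : 0 < 1 - α := by linarith [hα.2]
  have hc : (0:ℝ) < Fintype.card Y := by exact_mod_cast Fintype.card_pos
  rw [le_div_iff₀ h1, mul_comm, info_eq α hα]
  have := Real.log_le_log (by positivity) (phi_lower α hα W hW p hp)
  rw [Real.log_rpow (by positivity), Real.log_inv] at this
  have := mul_le_mul_of_nonneg_left this hα.1.le
  have e : α * (α⁻¹ * -Real.log (Fintype.card Y)) = -Real.log (Fintype.card Y) := by
    have := hα.1.ne'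
    field_simp
  linarith

lemma info_le_cap (α : ℝ) (hα : α ∈ Set.Ioo (0:ℝ) 1) (W : X → Y → ℝ) (hW : ∀ x, IsPMF (W x))
    (p : X → ℝ) (hp : IsPMF p) : renyiInfo α p W ≤ renyiCap α W := by
  refine le_csSup ⟨Real.log (Fintype.card Y) / (1-α), ?_⟩ ⟨p, hp, rfl⟩
  rintro _ ⟨p', hp', rfl⟩
  exact cap_bdd α hα W hW p' hp'

lemma cap_le (α : ℝ) (hα : α ∈ Set.Ioo (0:ℝ) 1) (W : X → Y → ℝ) (hW : ∀ x, IsPMF (W x)) :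
    renyiCap α W ≤ Real.log (Fintype.card Y) / (1-α) := by
  classical
  obtain ⟨p, hp, _⟩ := exists_opt α hα W
  refine csSup_le ⟨_, p, hp, rfl⟩ ?_
  rintro _ ⟨p', hp', rfl⟩
  exact cap_bdd α hα W hW p' hp'

lemma cap_nonneg (α : ℝ) (hα : α ∈ Set.Ioo (0:ℝ) 1) (W : X → Y → ℝ) (hW : ∀ x, IsPMF (W x)) :
    0 ≤ renyiCap α W := by
  classical
  obtain ⟨x⟩ := ‹Nonempty X›
  have hp : IsPMF (fun x' => if x' = x then (1:ℝ) else 0) := ⟨fun _ => by positivity, by simp⟩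
  refine le_trans ?_ (info_le_cap α hα W hW _ hp)
  have h1 : 0 < 1 - α := by linarith [hα.2]
  have : phi α W (fun x' => if x' = x then (1:ℝ) else 0) = 1 := by
    unfold phi
    simp only [ite_mul, one_mul, zero_mul, Finset.sum_ite_eq', Finset.mem_univ, if_true]
    rw [← (hW x).2]
    refine Finset.sum_congr rfl fun y _ => ?_
    exact Real.rpow_rpow_inv ((hW x).1 y) hα.1.ne'
  have h := info_eq α hα W (fun x' => if x' = x then (1:ℝ) else 0)
  rw [this] at h
  simp at h
  rcases h with h | h
  · linarith
  · exact h.ge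

/-- The Rényi center. -/
lemma center (α : ℝ) (hα : α ∈ Set.Ioo (0:ℝ) 1) (W : X → Y → ℝ) (hW : ∀ x, IsPMF (W x)) :
    ∃ q : Y → ℝ, IsPMF q ∧ ∀ x, Real.exp (-((1-α) * renyiCap α W)) ≤
      ∑ y, W x y ^ α * q y ^ (1-α) := by
  classical
  obtain ⟨p, hp, hmin⟩ := exists_opt α hα W
  have hα0 := hα.1
  have hα1 : 0 < 1 - α := by linarith [hα.2]
  set s : Y → ℝ := fun y => ∑ x, p x * W x y ^ α with hs
  have hs0 : ∀ y, 0 ≤ s y := fun y =>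
    Finset.sum_nonneg fun x _ => mul_nonneg (hp.1 x) (Real.rpow_nonneg ((hW x).1 y) _)
  have hφ : phi α W p = ∑ y, s y ^ α⁻¹ := rfl
  have hφpos : 0 < phi α W p := phi_pos α hα W hW p hp
  have hαinv : 1 < α⁻¹ := (one_lt_inv₀ hα0).2 hα.2
  refine ⟨fun y => s y ^ α⁻¹ / phi α W p, ⟨fun y => div_nonneg (Real.rpow_nonneg (hs0 y) _) hφpos.le, ?_⟩, ?_⟩
  · rw [← Finset.sum_div, ← hφ, div_self hφpos.ne']
  intro x
  -- derivative condition
  have key : 0 ≤ ∑ y, (W x y ^ α - s y) * α⁻¹ * s y ^ (α⁻¹ - 1) := by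
    set F : ℝ → ℝ := fun h => ∑ y, (s y + h * (W x y ^ α - s y)) ^ α⁻¹ with hF
    have hd : HasDerivAt F (∑ y, (W x y ^ α - s y) * α⁻¹ * s y ^ (α⁻¹ - 1)) 0 := by
      refine HasDerivAt.fun_sum fun y _ => ?_
      have h1 : HasDerivAt (fun h : ℝ => s y + h * (W x y ^ α - s y)) (W x y ^ α - s y) 0 := by
        have := ((hasDerivAt_id (0:ℝ)).mul_const (W x y ^ α - s y)).const_add (s y)
        simpa using this
      have := h1.rpow_const (p := α⁻¹) (Or.inr hαinv.le)
      simpa using this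
    have hmin' : ∀ h ∈ Set.Icc (0:ℝ) 1, F 0 ≤ F h := by
      intro h hh
      have e : F h = phi α W (fun x' => (1-h) * p x' + h * (if x' = x then 1 else 0)) := by
        simp only [hF, phi]
        refine Finset.sum_congr rfl fun y _ => ?_
        congr 1
        simp only [add_mul, Finset.sum_add_distrib, mul_assoc, ← Finset.mul_sum, ite_mul, one_mul, zero_mul,
          Finset.sum_ite_eq', Finset.mem_univ, if_true]
        simp only [hs]; ring
      have e0 : F 0 = phi α W p := by simp [hF, hφ]
      rw [e, e0]
      refine hmin _ ⟨fun x' => ?_, ?_⟩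
      · have h1 := hp.1 x'
        have h2 : 0 ≤ 1 - h := by linarith [hh.2]
        have h3 := hh.1
        positivity
      · simp [Finset.sum_add_distrib, ← Finset.mul_sum, hp.2]
    have ht := hd.hasDerivWithinAt (s := Set.Ioi 0)
    rw [hasDerivWithinAt_iff_tendsto_slope' (by simp)] at ht
    refine ge_of_tendsto ht ?_
    filter_upwards [Ioo_mem_nhdsGT (show (0:ℝ) < 1 by norm_num)] with h hh
    rw [slope_def_field]
    exact div_nonneg (by linarith [hmin' h ⟨hh.1.le, hh.2.le⟩]) (by linarith [hh.1])
  have key2 : phi α W p ≤ ∑ y, W x y ^ α * s y ^ (α⁻¹ - 1) := by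
    have e : ∑ y, (W x y ^ α - s y) * α⁻¹ * s y ^ (α⁻¹ - 1)
        = α⁻¹ * ((∑ y, W x y ^ α * s y ^ (α⁻¹ - 1)) - phi α W p) := by
      rw [hφ, ← Finset.sum_sub_distrib, Finset.mul_sum]
      refine Finset.sum_congr rfl fun y _ => ?_
      have : s y ^ α⁻¹ = s y * s y ^ (α⁻¹ - 1) := by
        rw [← Real.rpow_one_add' (hs0 y) (by ring_nf; linarith)]; ring_nf
      rw [this]; ring
    rw [e] at key
    have := nonneg_of_mul_nonneg_right key (inv_pos.2 hα0)
    linarith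
  have e3 : ∑ y, W x y ^ α * (s y ^ α⁻¹ / phi α W p) ^ (1-α)
      = (∑ y, W x y ^ α * s y ^ (α⁻¹ - 1)) / (phi α W p) ^ (1-α) := by
    rw [Finset.sum_div]
    refine Finset.sum_congr rfl fun y _ => ?_
    rw [Real.div_rpow (Real.rpow_nonneg (hs0 y) _) hφpos.le, ← Real.rpow_mul (hs0 y),
      show α⁻¹ * (1-α) = α⁻¹ - 1 by field_simp]
    ring
  rw [e3, le_div_iff₀ (by positivity)]
  refine le_trans ?_ key2
  have h1 := info_le_cap α hα W hW p hp
  have h2 := info_eq α hα W p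
  have h3 : Real.exp (-((1-α) * renyiCap α W)) ≤ (phi α W p) ^ α := by
    rw [Real.rpow_def_of_pos hφpos]
    refine Real.exp_le_exp.2 ?_
    have := mul_le_mul_of_nonneg_left h1 hα1.le
    linarith
  calc _ ≤ (phi α W p) ^ α * (phi α W p) ^ (1-α) := by gcongr
    _ = _ := by rw [← Real.rpow_add hφpos]; simp

lemma wmin_exists (W : X → Y → ℝ) (hW : ∀ x, IsPMF (W x)) :
    ∃ c : ℝ, 0 < c ∧ c ≤ 1 ∧ ∀ x y, 0 < W x y → c ≤ W x y := by
  classical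
  obtain ⟨z, hz⟩ := Finite.exists_min (fun z : X × Y => if 0 < W z.1 z.2 then W z.1 z.2 else 1)
  refine ⟨if 0 < W z.1 z.2 then W z.1 z.2 else 1, ?_, ?_, ?_⟩
  · split_ifs with h
    · exact h
    · exact one_pos
  · split_ifs with h
    · exact pmf_le_one (hW _) _
    · exact le_rfl
  · intro x y h
    have := hz (x, y)
    simpa [h] using this

/-- Single-letter lemma. -/
lemma letter (α : ℝ) (hα : α ∈ Set.Ioo (0:ℝ) 1) (W : X → Y → ℝ) (hW : ∀ x, IsPMF (W x))
    (c : ℝ) (hc0 : 0 < c) (hc1 : c ≤ 1) (hc : ∀ x y, 0 < W x y → c ≤ W x y)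
    (ε : ℝ) (hε0 : 0 < ε) (hε : ε ≤ 1/2) (L : ℝ)
    (hL : L = Real.log (1/ε) + (2 * Real.log (Fintype.card Y) + 1 + Real.log (1/c))) :
    ∃ q : Y → ℝ, IsPMF q ∧ ∃ v : X → Y → ℝ, (∀ x, IsPMF (v x)) ∧ ∀ x y, 0 < v x y →
      0 < W x y ∧ 0 < q y ∧ |Real.log (v x y / W x y)| ≤ L ∧ |Real.log (v x y / q y)| ≤ L ∧
      Real.log (v x y / W x y) + ((1-α)/α) * Real.log (v x y / q y) ≤
        ((1-α)/α) * (renyiCap α W + 2 * ε) := by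
  obtain ⟨q0, hq0, hcen⟩ := center α hα W hW
  have hα0 := hα.1
  have hα1 : 0 < 1 - α := by linarith [hα.2]
  have hY : (0:ℝ) < Fintype.card Y := by exact_mod_cast Fintype.card_pos
  have hY1 : (1:ℝ) ≤ Fintype.card Y := by exact_mod_cast Fintype.card_pos
  set q : Y → ℝ := fun y => (1-ε) * q0 y + ε / Fintype.card Y with hq
  have hqlow : ∀ y, ε / Fintype.card Y ≤ q y := fun y => by
    have : 0 ≤ (1-ε) * q0 y := mul_nonneg (by linarith) (hq0.1 y)
    simp only [hq]; linarith
  have hqpos : ∀ y, 0 < q y := fun y => (div_pos hε0 hY).trans_le (hqlow y)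
  have hqpmf : IsPMF q := by
    refine ⟨fun y => (hqpos y).le, ?_⟩
    simp only [hq, Finset.sum_add_distrib, ← Finset.mul_sum, hq0.2]
    simp
    field_simp
    ring
  set Z : X → ℝ := fun x => ∑ y, W x y ^ α * q y ^ (1-α) with hZ
  have hZlow : ∀ x, Real.exp (-((1-α) * (renyiCap α W + 2*ε))) ≤ Z x := by
    intro x
    have h1 : Real.exp (-(2*ε)) ≤ 1 - ε := by
      have h2 := Real.add_one_le_exp (2*ε)
      rw [Real.exp_neg, inv_le_comm₀ (Real.exp_pos _) (by linarith)]
      refine le_trans ?_ h2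
      rw [inv_le_iff_one_le_mul₀ (by linarith)]
      nlinarith
    have h2 : Real.exp (-((1-α) * (2*ε))) ≤ (1-ε)^(1-α) := by
      calc Real.exp (-((1-α) * (2*ε))) = (Real.exp (-(2*ε))) ^ (1-α) := by
            rw [← Real.exp_mul]; ring_nf
        _ ≤ _ := Real.rpow_le_rpow (Real.exp_pos _).le h1 hα1.le
    calc Real.exp (-((1-α) * (renyiCap α W + 2*ε)))
        = Real.exp (-((1-α) * (2*ε))) * Real.exp (-((1-α) * renyiCap α W)) := by
          rw [← Real.exp_add]; ring_nf
      _ ≤ (1-ε)^(1-α) * ∑ y, W x y ^ α * q0 y ^ (1-α) := by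
          gcongr
          · exact Real.rpow_nonneg (by linarith) _
          · exact hcen x
      _ ≤ Z x := by
          rw [Finset.mul_sum]
          refine Finset.sum_le_sum fun y _ => ?_
          have : (1-ε)^(1-α) * q0 y ^ (1-α) ≤ q y ^ (1-α) := by
            rw [← Real.mul_rpow (by linarith) (hq0.1 y)]
            refine Real.rpow_le_rpow (mul_nonneg (by linarith) (hq0.1 y)) ?_ hα1.le
            have := div_pos hε0 hY
            simp only [hq]; linarith
          have := mul_le_mul_of_nonneg_left this (Real.rpow_nonneg ((hW x).1 y) α)
          linarith
  have hZpos : ∀ x, 0 < Z x := fun x => (Real.exp_pos _).trans_le (hZlow x)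
  have hZ1 : ∀ x, Z x ≤ 1 := by
    intro x
    calc Z x ≤ ∑ y, (α * W x y + (1-α) * q y) := Finset.sum_le_sum fun y _ =>
          Real.geom_mean_le_arith_mean2_weighted hα0.le hα1.le ((hW x).1 y) (hqpos y).le (by ring)
      _ = 1 := by
          rw [Finset.sum_add_distrib, ← Finset.mul_sum, ← Finset.mul_sum, (hW x).2, hqpmf.2]; ring
  have hq1 : ∀ y, q y ≤ 1 := pmf_le_one hqpmf
  refine ⟨q, hqpmf, fun x y => W x y ^ α * q y ^ (1-α) / Z x, fun x => ⟨fun y => ?_, ?_⟩, ?_⟩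
  · exact div_nonneg (mul_nonneg (Real.rpow_nonneg ((hW x).1 y) _) (Real.rpow_nonneg (hqpos y).le _)) (hZpos x).le
  · rw [← Finset.sum_div]; exact div_self (hZpos x).ne'
  intro x y hv
  beta_reduce at hv ⊢
  have hw : 0 < W x y := by
    refine lt_of_le_of_ne ((hW x).1 y) fun h => ?_
    rw [← h, Real.zero_rpow hα0.ne'] at hv
    simp at hv
  have hqy := hqpos y
  have hZx := hZpos x
  have lv : Real.log (W x y ^ α * q y ^ (1-α) / Z x)
      = α * Real.log (W x y) + (1-α) * Real.log (q y) - Real.log (Z x) := by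
    rw [Real.log_div (by positivity) (by positivity), Real.log_mul (by positivity) (by positivity),
      Real.log_rpow hw, Real.log_rpow hqy]
  have l1 : Real.log (W x y ^ α * q y ^ (1-α) / Z x / W x y)
      = (1-α) * (Real.log (q y) - Real.log (W x y)) - Real.log (Z x) := by
    rw [Real.log_div hv.ne' hw.ne', lv]; ring
  have l2 : Real.log (W x y ^ α * q y ^ (1-α) / Z x / q y)
      = α * (Real.log (W x y) - Real.log (q y)) - Real.log (Z x) := by
    rw [Real.log_div hv.ne' hqy.ne', lv]; ring
  have b1 : Real.log (q y) ≤ 0 := Real.log_nonpos hqy.le (hq1 y)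
  have b2 : Real.log (W x y) ≤ 0 := Real.log_nonpos hw.le (pmf_le_one (hW x) y)
  have b3 : -Real.log (1/ε) - Real.log (Fintype.card Y) ≤ Real.log (q y) := by
    have := Real.log_le_log (by positivity) (hqlow y)
    rw [Real.log_div hε0.ne' hY.ne'] at this
    rw [one_div, Real.log_inv]; linarith
  have b4 : -Real.log (1/c) ≤ Real.log (W x y) := by
    have := Real.log_le_log hc0 (hc x y hw)
    rw [one_div, Real.log_inv]; linarith
  have b5 : Real.log (Z x) ≤ 0 := Real.log_nonpos hZx.le (hZ1 x)
  have b6 : -((1-α) * (renyiCap α W + 2*ε)) ≤ Real.log (Z x) := by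
    rw [Real.le_log_iff_exp_le hZx]; exact hZlow x
  have b7 : (1-α) * renyiCap α W ≤ Real.log (Fintype.card Y) := by
    have := cap_le α hα W hW
    rw [le_div_iff₀ hα1] at this
    linarith
  have b8 : -(Real.log (Fintype.card Y) + 1) ≤ Real.log (Z x) := by
    have : (1-α) * (2*ε) ≤ 1 * 1 := mul_le_mul (by linarith) (by linarith) (by linarith) (by norm_num)
    linarith
  have b9 : 0 ≤ Real.log (Fintype.card Y) := Real.log_nonneg hY1
  have b10 : 0 ≤ Real.log (1/ε) := Real.log_nonneg (by rw [le_div_iff₀ hε0]; linarith)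
  have b11 : 0 ≤ Real.log (1/c) := Real.log_nonneg (by rw [le_div_iff₀ hc0]; linarith)
  refine ⟨hw, hqy, ?_, ?_, ?_⟩
  · rw [l1, abs_le, hL]
    constructor <;> nlinarith
  · rw [l2, abs_le, hL]
    constructor <;> nlinarith [hα.2]
  · rw [l1, l2]
    have e : (1 - α) * (Real.log (q y) - Real.log (W x y)) - Real.log (Z x) +
        (1 - α) / α * (α * (Real.log (W x y) - Real.log (q y)) - Real.log (Z x))
        = - Real.log (Z x) / α := by field_simp; ring
    rw [e, div_mul_eq_mul_div]
    gcongr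
    linarith

end letter

section block
variable {X Y : Type*} [Fintype X] [Fintype Y]

/-- pointwise bounds on a block. -/
lemma block_pt (W v : X → Y → ℝ) (q : Y → ℝ) (L ρ C : ℝ)
    (hv0 : ∀ x y, 0 ≤ v x y)
    (h : ∀ x y, 0 < v x y → 0 < W x y ∧ 0 < q y ∧ |Real.log (v x y / W x y)| ≤ L ∧
      |Real.log (v x y / q y)| ≤ L ∧
      Real.log (v x y / W x y) + ρ * Real.log (v x y / q y) ≤ ρ * C)
    (y : List Y) (e : List Y → X) (hy : 0 < P (fun h => v (e h)) y) :
    0 < P (fun h => W (e h)) y ∧ 0 < P (fun _ => q) y ∧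
    |Real.log (P (fun h => v (e h)) y / P (fun h => W (e h)) y)| ≤ y.length * L ∧
    |Real.log (P (fun h => v (e h)) y / P (fun _ => q) y)| ≤ y.length * L ∧
    Real.log (P (fun h => v (e h)) y / P (fun h => W (e h)) y) +
      ρ * Real.log (P (fun h => v (e h)) y / P (fun _ => q) y) ≤ y.length * (ρ * C) := by
  induction y generalizing e with
  | nil => simp [P]
  | cons a t ih =>
    simp only [P] at hy ⊢
    have hva : 0 < v (e []) a := by
      refine lt_of_le_of_ne (hv0 _ _) fun h0 => ?_
      rw [← h0] at hy; simp at hy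
    have hvt : 0 < P (fun h => v (e (a :: h))) t := pos_of_mul_pos_right hy hva.le
    obtain ⟨a1, a2, a3, a4, a5⟩ := h _ _ hva
    obtain ⟨b1, b2, b3, b4, b5⟩ := ih (fun h => e (a :: h)) hvt
    have e1 : Real.log (v (e []) a * P (fun h => v (e (a :: h))) t /
        (W (e []) a * P (fun h => W (e (a :: h))) t)) =
        Real.log (v (e []) a / W (e []) a) +
        Real.log (P (fun h => v (e (a :: h))) t / P (fun h => W (e (a :: h))) t) := by
      rw [← Real.log_mul (by positivity) (by positivity), div_mul_div_comm]
    have e2 : Real.log (v (e []) a * P (fun h => v (e (a :: h))) t /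
        (q a * P (fun _ => q) t)) =
        Real.log (v (e []) a / q a) +
        Real.log (P (fun h => v (e (a :: h))) t / P (fun _ => q) t) := by
      rw [← Real.log_mul (by positivity) (by positivity), div_mul_div_comm]
    rw [e1, e2]
    push_cast [List.length_cons]
    refine ⟨by positivity, by positivity, ?_, ?_, ?_⟩
    · refine (abs_add_le _ _).trans ?_; linarith
    · refine (abs_add_le _ _).trans ?_; linarith
    · linarith

/-- Block lemma: choice of the mixture and moment bounds. -/
lemma block (W : X → Y → ℝ) (hW : ∀ x, IsPMF (W x)) (K : ℕ) (hK : 0 < K)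
    (v : ℕ → X → Y → ℝ) (q : ℕ → Y → ℝ) (L Δ θ R E κ : ℝ) (C : ℕ → ℝ) (l : ℕ)
    (hv : ∀ j x, IsPMF (v j x)) (hq : ∀ j, IsPMF (q j)) (hΔ : 0 < Δ)
    (hθ : 0 ≤ θ) (hθl : θ * (l * L) ≤ 1)
    (h : ∀ j < K, ∀ x y, 0 < v j x y → 0 < W x y ∧ 0 < q j y ∧ |Real.log (v j x y / W x y)| ≤ L ∧
      |Real.log (v j x y / q j y)| ≤ L ∧
      Real.log (v j x y / W x y) + (((j:ℝ)+1)*Δ) * Real.log (v j x y / q j y) ≤ (((j:ℝ)+1)*Δ) * C j)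
    (hC : ∀ j < K, (((j:ℝ)+1)*Δ) * (C j - R) ≤ E + κ) (hlast : C (K-1) ≤ R)
    (e : List Y → X) :
    ∃ lam : Fin K → ℝ, (∀ j, 0 ≤ lam j) ∧ ∑ j, lam j = 1 ∧
      ∑ j : Fin K, lam j * S l (fun y => P (fun h => v j (e h)) y *
        (P (fun h => v j (e h)) y / P (fun h => W (e h)) y) ^ θ)
        ≤ Real.exp (θ * (l * (E + κ + Δ * R)) + (θ * (l * L))^2) ∧
      ∑ j : Fin K, lam j * S l (fun y => P (fun h => v j (e h)) y *
        (P (fun h => v j (e h)) y / P (fun _ => q j) y) ^ θ)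
        ≤ Real.exp (θ * (l * R) + (θ * (l * L))^2) := by
  set V : ℕ → List Y → ℝ := fun j => P (fun h => v j (e h)) with hVd
  set w : List Y → ℝ := P (fun h => W (e h)) with hwd
  set Q : ℕ → List Y → ℝ := fun j => P (fun _ => q j) with hQd
  have hV0 : ∀ j y, 0 ≤ V j y := fun j y => P_nonneg _ (fun h a => (hv j _).1 a) y
  have hw0 : ∀ y, 0 ≤ w y := fun y => P_nonneg _ (fun h a => (hW _).1 a) y
  have hQ0 : ∀ j y, 0 ≤ Q j y := fun j y => P_nonneg _ (fun h a => (hq j).1 a) y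
  have hV1 : ∀ j, S l (V j) = 1 := fun j => P_sum _ (fun h => (hv j _).2) l
  have hw1 : S l w = 1 := P_sum _ (fun h => (hW _).2) l
  have hQ1 : ∀ j, S l (Q j) = 1 := fun j => P_sum _ (fun h => (hq j).2) l
  have hpt : ∀ j < K, ∀ y : List Y, y.length = l → 0 < V j y → 0 < w y ∧ 0 < Q j y ∧
      |Real.log (V j y / w y)| ≤ l * L ∧ |Real.log (V j y / Q j y)| ≤ l * L ∧
      Real.log (V j y / w y) + (((j:ℝ)+1)*Δ) * Real.log (V j y / Q j y) ≤ l * ((((j:ℝ)+1)*Δ) * C j) := by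
    intro j hj y hy hpos
    have := block_pt W (v j) (q j) L (((j:ℝ)+1)*Δ) (C j) (fun x y => (hv j x).1 y) (h j hj) y e hpos
    rw [hy] at this
    exact this
  set g : ℕ → ℝ := fun j => S l (fun y => V j y * Real.log (V j y / w y)) with hg
  set f : ℕ → ℝ := fun j => S l (fun y => V j y * Real.log (V j y / Q j y)) with hf
  have hg0 : ∀ j < K, 0 ≤ g j := by
    intro j hj
    have : S l (fun y => V j y - w y) ≤ g j :=
      S_mono fun y hy => gibbs_pt (hV0 j y) (hw0 y) fun hp => (hpt j hj y hy hp).1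
    rw [S_sub, hV1, hw1] at this; linarith
  have hf0 : ∀ j < K, 0 ≤ f j := by
    intro j hj
    have : S l (fun y => V j y - Q j y) ≤ f j :=
      S_mono fun y hy => gibbs_pt (hV0 j y) (hQ0 j y) fun hp => (hpt j hj y hy hp).2.1
    rw [S_sub, hV1, hQ1] at this; linarith
  have hgf : ∀ j < K, g j + (((j:ℝ)+1)*Δ) * f j ≤ l * ((((j:ℝ)+1)*Δ) * C j) := by
    intro j hj
    have : S l (fun y => V j y * Real.log (V j y / w y) + (((j:ℝ)+1)*Δ) * (V j y * Real.log (V j y / Q j y)))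
        ≤ S l (fun y => (l * ((((j:ℝ)+1)*Δ) * C j)) * V j y) := by
      refine S_mono fun y hy => ?_
      rcases (hV0 j y).eq_or_lt with h0 | h0
      · rw [← h0]; simp
      · have := mul_le_mul_of_nonneg_left (hpt j hj y hy h0).2.2.2.2 h0.le
        linarith
    rw [S_plus, S_mul, S_mul, hV1] at this
    simp only [hg, hf]; linarith
  have hK1 : K - 1 < K := by omega
  have hlastf : f (K-1) ≤ l * R := by
    have h1 := hgf _ hK1
    have h2 := hg0 _ hK1
    set ρ := (((K-1:ℕ):ℝ)+1)*Δ with hρ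
    have hρ0 : 0 < ρ := by positivity
    have : ρ * f (K-1) ≤ ρ * (l * C (K-1)) := by linarith
    have := le_of_mul_le_mul_left this hρ0
    refine this.trans ?_
    gcongr
  obtain ⟨lam, hl0, hl1, hlf, hlg⟩ := select K hK (fun j => if j < K then f j else 0) (l * R) Δ hΔ.le
    (fun j => by split_ifs with hj; exacts [hf0 j hj, le_rfl]) (by simpa [hK1] using hlastf)
  simp only [Fin.is_lt, if_true] at hlf hlg
  refine ⟨lam, hl0, hl1, ?_, ?_⟩
  · have m1 : ∀ j : Fin K, S l (fun y => V j y * (V j y / w y) ^ θ) ≤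
        (1 + (θ * (l*L))^2) + θ * g j := by
      intro j
      have : S l (fun y => V j y * (V j y / w y) ^ θ) ≤
          S l (fun y => (1 + (θ * (l*L))^2) * V j y + θ * (V j y * Real.log (V j y / w y))) := by
        refine S_mono fun y hy => ?_
        have := mom_pt (v := V j y) (q := w y) (θ := θ) (c := l * L) (hV0 j y) hθ
          (fun hp => ⟨(hpt j j.2 y hy hp).1, (hpt j j.2 y hy hp).2.2.1⟩) hθl
        linarith
      rw [S_plus, S_mul, S_mul, hV1, mul_one] at this
      exact this
    have m2 : ∀ j : Fin K, g j ≤ l * (E + κ) + (((j:ℕ):ℝ)+1) * Δ * (l * R - f j) := by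
      intro j
      have h1 := hgf j j.2
      have h2 := mul_le_mul_of_nonneg_left (hC j j.2) (Nat.cast_nonneg (α := ℝ) l)
      linarith
    calc ∑ j : Fin K, lam j * S l (fun y => V j y * (V j y / w y) ^ θ)
        ≤ ∑ j : Fin K, lam j * ((1 + (θ * (l*L))^2) + θ * (l * (E + κ) + (((j:ℕ):ℝ)+1) * Δ * (l * R - f j))) := by
          refine Finset.sum_le_sum fun j _ => mul_le_mul_of_nonneg_left ?_ (hl0 j)
          exact (m1 j).trans (by gcongr; exact m2 j)
      _ = (1 + (θ * (l*L))^2 + θ * (l * (E+κ))) * ∑ j, lam j +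
            θ * ∑ j : Fin K, lam j * ((((j:ℕ):ℝ)+1) * Δ * (l * R - f j)) := by
          rw [Finset.mul_sum, Finset.mul_sum, ← Finset.sum_add_distrib]
          refine Finset.sum_congr rfl fun j _ => ?_
          ring
      _ ≤ (1 + (θ * (l*L))^2 + θ * (l * (E+κ))) * 1 + θ * (Δ * (l * R)) := by
          rw [hl1]; gcongr
      _ = (θ * (l * (E + κ + Δ * R)) + (θ * (l * L))^2) + 1 := by ring
      _ ≤ _ := Real.add_one_le_exp _
  · have m1 : ∀ j : Fin K, S l (fun y => V j y * (V j y / Q j y) ^ θ) ≤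
        (1 + (θ * (l*L))^2) + θ * f j := by
      intro j
      have : S l (fun y => V j y * (V j y / Q j y) ^ θ) ≤
          S l (fun y => (1 + (θ * (l*L))^2) * V j y + θ * (V j y * Real.log (V j y / Q j y))) := by
        refine S_mono fun y hy => ?_
        have := mom_pt (v := V j y) (q := Q j y) (θ := θ) (c := l * L) (hV0 j y) hθ
          (fun hp => ⟨(hpt j j.2 y hy hp).2.1, (hpt j j.2 y hy hp).2.2.2.1⟩) hθl
        linarith
      rw [S_plus, S_mul, S_mul, hV1, mul_one] at this
      exact this
    calc ∑ j : Fin K, lam j * S l (fun y => V j y * (V j y / Q j y) ^ θ)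
        ≤ ∑ j : Fin K, lam j * ((1 + (θ * (l*L))^2) + θ * f j) := by
          refine Finset.sum_le_sum fun j _ => mul_le_mul_of_nonneg_left (m1 j) (hl0 j)
      _ = (1 + (θ * (l*L))^2) * ∑ j, lam j + θ * ∑ j : Fin K, lam j * f j := by
          rw [Finset.mul_sum, Finset.mul_sum, ← Finset.sum_add_distrib]
          refine Finset.sum_congr rfl fun j _ => ?_
          ring
      _ ≤ (1 + (θ * (l*L))^2) * 1 + θ * (l * R) := by
          rw [hl1]; gcongr
      _ = (θ * (l * R) + (θ * (l * L))^2) + 1 := by ring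
      _ ≤ _ := Real.add_one_le_exp _

/-- The reference output measure. -/
noncomputable def Qf (K : ℕ) (q : ℕ → Y → ℝ) (l : ℕ) : ℕ → List Y → ℝ
  | 0, y => P (fun _ _ => (Fintype.card Y : ℝ)⁻¹) y
  | N+1, y => (∑ j : Fin K, (K:ℝ)⁻¹ * P (fun _ => q j) (y.take l)) * Qf K q l N (y.drop l)

lemma Qf_nonneg (K : ℕ) (q : ℕ → Y → ℝ) (l : ℕ) (hq : ∀ j, IsPMF (q j)) (N : ℕ) (y : List Y) :
    0 ≤ Qf K q l N y := by
  induction N generalizing y with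
  | zero => exact P_nonneg _ (fun _ _ => by positivity) y
  | succ N ih =>
    refine mul_nonneg (Finset.sum_nonneg fun j _ => mul_nonneg (by positivity) ?_) (ih _)
    exact P_nonneg _ (fun _ a => (hq j).1 a) _

lemma Qf_append (K : ℕ) (q : ℕ → Y → ℝ) (N : ℕ) (y z : List Y) :
    Qf K q y.length (N+1) (y ++ z) =
      (∑ j : Fin K, (K:ℝ)⁻¹ * P (fun _ => q j) y) * Qf K q y.length N z := by
  simp [Qf]

lemma Qf_sum [Nonempty Y] (K : ℕ) (hK : 0 < K) (q : ℕ → Y → ℝ) (l r : ℕ) (hq : ∀ j, IsPMF (q j)) (N : ℕ) :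
    S (N*l+r) (Qf K q l N) = 1 := by
  induction N with
  | zero =>
    rw [zero_mul, zero_add]
    refine P_sum _ (fun h => ?_) r
    simp
  | succ N ih =>
    rw [show (N+1)*l+r = l + (N*l+r) by ring, S_add]
    have : S l (fun y => S (N*l+r) (fun z => Qf K q l (N+1) (y ++ z))) =
        S l (fun y => ∑ j : Fin K, (K:ℝ)⁻¹ * P (fun _ => q j) y) := by
      refine S_congr fun y hy => ?_
      subst hy
      simp only [Qf_append]
      rw [S_mul, ih, mul_one]
    rw [this, S_sum]
    have h2 : ∀ j : Fin K, S l (fun y => (K:ℝ)⁻¹ * P (fun _ => q j) y) = (K:ℝ)⁻¹ := by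
      intro j
      rw [S_mul]
      have := P_sum (fun _ => q j) (fun _ => (hq j).2) l
      rw [this, mul_one]
    simp only [h2]
    have : (K:ℝ) ≠ 0 := by positivity
    simp [this]

lemma min_base {u v θ : ℝ} (hu : 0 < u) (hv : 0 < v) (hθ : 0 ≤ θ) :
    1 - u ^ (-θ) - v ^ (-θ) ≤ min u v := by
  have pu := Real.rpow_nonneg hu.le (-θ)
  have pv := Real.rpow_nonneg hv.le (-θ)
  refine le_min ?_ ?_
  · rcases le_total 1 u with h | h
    · linarith
    · have := Real.one_le_rpow_of_pos_of_le_one_of_nonpos hu h (neg_nonpos.2 hθ)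
      linarith
  · rcases le_total 1 v with h | h
    · linarith
    · have := Real.one_le_rpow_of_pos_of_le_one_of_nonpos hv h (neg_nonpos.2 hθ)
      linarith

lemma chain [Nonempty Y] (W : X → Y → ℝ) (hW : ∀ x, IsPMF (W x)) (K : ℕ) (hK : 0 < K)
    (v : ℕ → X → Y → ℝ) (q : ℕ → Y → ℝ) (θ A B : ℝ) (l r : ℕ)
    (hv : ∀ j x, IsPMF (v j x)) (hq : ∀ j, IsPMF (q j)) (hθ : 0 ≤ θ) (hA : 0 ≤ A) (hB : 0 ≤ B)
    (hsupp : ∀ j < K, ∀ (e : List Y → X) (y : List Y), 0 < P (fun h => v j (e h)) y →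
      0 < P (fun h => W (e h)) y ∧ 0 < P (fun _ => q j) y)
    (hblock : ∀ e : List Y → X, ∃ lam : Fin K → ℝ, (∀ j, 0 ≤ lam j) ∧ ∑ j, lam j = 1 ∧
      ∑ j : Fin K, lam j * S l (fun y => P (fun h => v j (e h)) y *
        (P (fun h => v j (e h)) y / P (fun h => W (e h)) y) ^ θ) ≤ A ∧
      ∑ j : Fin K, lam j * S l (fun y => P (fun h => v j (e h)) y *
        (P (fun h => v j (e h)) y / P (fun _ => q j) y) ^ θ) ≤ B)
    (N : ℕ) : ∀ (e : List Y → X) (a b : ℝ), 0 < a → 0 < b →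
    1 - a ^ (-θ) * A ^ N - b ^ (-θ) * (((Fintype.card Y : ℝ) ^ r) ^ θ * ((K:ℝ)^θ * B) ^ N) ≤
      S (N*l+r) (fun y => min (a * P (fun h => W (e h)) y) (b * Qf K q l N y)) := by
  have hY : (0:ℝ) < Fintype.card Y := by exact_mod_cast Fintype.card_pos
  have hKr : (0:ℝ) < K := by exact_mod_cast hK
  induction N with
  | zero =>
    intro e a b ha hb
    rw [zero_mul, zero_add, pow_zero, pow_zero, mul_one, mul_one]
    have hPQ : ∀ y : List Y, P (fun _ _ => (Fintype.card Y : ℝ)⁻¹) y = ((Fintype.card Y : ℝ)⁻¹) ^ y.length := by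
      intro y
      induction y with
      | nil => simp [P]
      | cons c t ih => simp only [P, ih, List.length_cons]; ring
    have h1 : S r (fun y => (min a (b * ((Fintype.card Y : ℝ)^r)⁻¹)) * P (fun h => W (e h)) y)
        ≤ S r (fun y => min (a * P (fun h => W (e h)) y) (b * Qf K q l 0 y)) := by
      refine S_mono fun y hy => ?_
      have p0 : 0 ≤ P (fun h => W (e h)) y := P_nonneg _ (fun h a => (hW _).1 a) y
      have p1 : P (fun h => W (e h)) y ≤ 1 :=
        P_le_one _ (fun h a => (hW _).1 a) (fun h a => pmf_le_one (hW _) a) y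
      refine le_min ?_ ?_
      · exact mul_le_mul_of_nonneg_right (min_le_left _ _) p0
      · rw [Qf, hPQ, hy, inv_pow]
        calc _ ≤ (b * ((Fintype.card Y : ℝ)^r)⁻¹) * 1 :=
              mul_le_mul (min_le_right _ _) p1 p0 (by positivity)
          _ = _ := mul_one _
    rw [S_mul, show S r (fun y => P (fun h => W (e h)) y) = 1 from P_sum _ (fun h => (hW _).2) r, mul_one] at h1
    refine le_trans ?_ h1
    refine le_trans (le_of_eq ?_) (min_base (θ := θ) ha (show 0 < b * ((Fintype.card Y : ℝ)^r)⁻¹ by positivity) hθ)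
    rw [Real.mul_rpow hb.le (by positivity), Real.inv_rpow (by positivity), ← Real.rpow_neg (by positivity), neg_neg]
  | succ N ih =>
    intro e a b ha hb
    obtain ⟨lam, hl0, hl1, hlA, hlB⟩ := hblock e
    set V : Fin K → List Y → ℝ := fun j => P (fun h => v j (e h)) with hVd
    set w : List Y → ℝ := P (fun h => W (e h)) with hwd
    set Q : Fin K → List Y → ℝ := fun j => P (fun _ => q j) with hQd
    have hV0 : ∀ j y, 0 ≤ V j y := fun j y => P_nonneg _ (fun h a => (hv j _).1 a) y
    have hw0 : ∀ y, 0 ≤ w y := fun y => P_nonneg _ (fun h a => (hW _).1 a) y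
    have hQ0 : ∀ j y, 0 ≤ Q j y := fun j y => P_nonneg _ (fun h a => (hq j).1 a) y
    have hV1 : ∀ j, S l (V j) = 1 := fun j => P_sum _ (fun h => (hv j _).2) l
    set D := ((Fintype.card Y : ℝ) ^ r) ^ θ * ((K:ℝ)^θ * B) ^ N with hD
    have hD0 : 0 ≤ D := by positivity
    rw [show (N+1)*l+r = l + (N*l+r) by ring, S_add]
    -- per (y, j) bound
    have hstep : ∀ y : List Y, y.length = l → ∀ j : Fin K,
        lam j * (V j y - a ^ (-θ) * A ^ N * (V j y * (V j y / w y) ^ θ)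
          - b ^ (-θ) * (K:ℝ)^θ * D * (V j y * (V j y / Q j y) ^ θ)) ≤
        S (N*l+r) (fun z => min (lam j * (a * (w y * P (fun h => W (e (y ++ h))) z)))
          ((K:ℝ)⁻¹ * Q j y * (b * Qf K q l N z))) := by
      intro y hy j
      have hrhs : 0 ≤ S (N*l+r) (fun z => min (lam j * (a * (w y * P (fun h => W (e (y ++ h))) z)))
          ((K:ℝ)⁻¹ * Q j y * (b * Qf K q l N z))) := by
        refine Finset.sum_nonneg fun z _ => le_min ?_ ?_
        · have := P_nonneg (fun h => W (e (y ++ h))) (fun h a => (hW _).1 a) (List.ofFn z)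
          have := hw0 y
          have := hl0 j
          positivity
        · have := Qf_nonneg K q l hq N (List.ofFn z)
          have := hQ0 j y
          positivity
      rcases (hl0 j).eq_or_lt with hj0 | hj0
      · rw [← hj0, zero_mul]; rw [← hj0] at hrhs; exact hrhs
      rcases (hV0 j y).eq_or_lt with hv0 | hv0
      · rw [← hv0]; simpa using hrhs
      obtain ⟨hwp, hQp⟩ := hsupp j j.2 e y hv0
      change 0 < w y at hwp
      change 0 < Q j y at hQp
      have hlam1 : lam j ≤ 1 := by
        rw [← hl1]; exact Finset.single_le_sum (fun i _ => hl0 i) (Finset.mem_univ j)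
      have hih := ih (fun h => e (y ++ h)) (a * (w y / V j y)) (b * (Q j y / (K * V j y)))
        (by positivity) (by positivity)
      have hih2 := mul_le_mul_of_nonneg_left hih (mul_pos hj0 hv0).le
      rw [← S_mul] at hih2
      have hmono : S (N*l+r) (fun z => lam j * V j y * min (a * (w y / V j y) * P (fun h => W (e (y ++ h))) z)
          (b * (Q j y / (K * V j y)) * Qf K q l N z)) ≤
          S (N*l+r) (fun z => min (lam j * (a * (w y * P (fun h => W (e (y ++ h))) z)))
          ((K:ℝ)⁻¹ * Q j y * (b * Qf K q l N z))) := by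
        refine S_mono fun z _ => ?_
        rw [mul_min_of_nonneg _ _ (mul_pos hj0 hv0).le]
        refine min_le_min (le_of_eq (by field_simp)) ?_
        have e1 : lam j * V j y * (b * (Q j y / (K * V j y)) * Qf K q l N z)
          = lam j * ((K:ℝ)⁻¹ * Q j y * (b * Qf K q l N z)) := by field_simp
        rw [e1]
        have := Qf_nonneg K q l hq N z
        exact mul_le_of_le_one_left (by positivity) hlam1
      refine le_trans (le_of_eq ?_) (hih2.trans hmono)
      have r1 : (a * (w y / V j y)) ^ (-θ) = a ^ (-θ) * (V j y / w y) ^ θ := by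
        rw [Real.mul_rpow ha.le (by positivity), Real.rpow_neg (by positivity : (0:ℝ) ≤ w y / V j y),
          ← Real.inv_rpow (by positivity), inv_div]
      have r2 : (b * (Q j y / (K * V j y))) ^ (-θ) = b ^ (-θ) * ((K:ℝ)^θ * (V j y / Q j y) ^ θ) := by
        rw [Real.mul_rpow hb.le (by positivity), Real.rpow_neg (by positivity : (0:ℝ) ≤ Q j y / (K * V j y)),
          ← Real.inv_rpow (by positivity), inv_div, mul_div_assoc, Real.mul_rpow (by positivity) (by positivity)]
      rw [r1, r2]
      ring
    -- assemble
    have hbig : S l (fun y => ∑ j, lam j * (V j y - a ^ (-θ) * A ^ N * (V j y * (V j y / w y) ^ θ)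
          - b ^ (-θ) * (K:ℝ)^θ * D * (V j y * (V j y / Q j y) ^ θ))) ≤
        S l (fun y => S (N*l+r) (fun z => min (a * P (fun h => W (e h)) (y ++ z)) (b * Qf K q l (N+1) (y ++ z)))) := by
      refine S_mono fun y hy => ?_
      refine (Finset.sum_le_sum fun j _ => hstep y hy j).trans ?_
      rw [← S_sum]
      refine S_mono fun z _ => ?_
      refine le_min ?_ ?_
      · refine (Finset.sum_le_sum fun j _ => min_le_left _ _).trans (le_of_eq ?_)
        rw [← Finset.sum_mul, hl1, one_mul, P_append]
      · refine (Finset.sum_le_sum fun j _ => min_le_right _ _).trans (le_of_eq ?_)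
        rw [← Finset.sum_mul]
        subst hy
        rw [Qf_append]
        ring
    refine le_trans ?_ hbig
    rw [S_sum]
    have hS : ∀ j : Fin K, S l (fun y => lam j * (V j y - a ^ (-θ) * A ^ N * (V j y * (V j y / w y) ^ θ)
          - b ^ (-θ) * (K:ℝ)^θ * D * (V j y * (V j y / Q j y) ^ θ))) =
        lam j - a ^ (-θ) * A ^ N * (lam j * S l (fun y => V j y * (V j y / w y) ^ θ))
          - b ^ (-θ) * (K:ℝ)^θ * D * (lam j * S l (fun y => V j y * (V j y / Q j y) ^ θ)) := by
      intro j
      rw [S_mul, S_sub, S_sub, S_mul, S_mul]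
      rw [show S l (fun y => V j y) = 1 from hV1 j]
      ring
    simp only [hS]
    rw [Finset.sum_sub_distrib, Finset.sum_sub_distrib, hl1, ← Finset.mul_sum, ← Finset.mul_sum]
    have t1 := mul_le_mul_of_nonneg_left hlA (show 0 ≤ a ^ (-θ) * A ^ N by positivity)
    have t2 := mul_le_mul_of_nonneg_left hlB (show 0 ≤ b ^ (-θ) * (K:ℝ)^θ * D by positivity)
    have t3 : a ^ (-θ) * A ^ (N+1) = a ^ (-θ) * A ^ N * A := by ring
    have t4 : b ^ (-θ) * (((Fintype.card Y : ℝ) ^ r) ^ θ * ((K:ℝ)^θ * B) ^ (N+1)) = b ^ (-θ) * (K:ℝ)^θ * D * B := by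
      rw [hD]; ring
    rw [t3, t4]
    linarith

end block

section final
variable {X Y : Type*} [Fintype X] [Fintype Y] [Nonempty X] [Nonempty Y]

open Classical in
/-- The encoder as a function of lists. -/
noncomputable def encL {n M : ℕ} (enc : Fin M → ∀ t : Fin n, (Fin t → Y) → X) (m : Fin M)
    (h : List Y) : X :=
  if hh : h.length < n then enc m ⟨h.length, hh⟩ (fun s => h.get s) else Classical.arbitrary X

lemma encL_ofFn {n M : ℕ} (enc : Fin M → ∀ t : Fin n, (Fin t → Y) → X) (m : Fin M)
    (t : Fin n) (g : Fin t → Y) : encL enc m (List.ofFn g) = enc m t g := by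
  have key : ∀ (h : List Y) (k : ℕ) (hk : k < n) (hl : h.length = k),
      encL enc m h = enc m ⟨k, hk⟩ (fun s => h.get (Fin.cast hl.symm s)) := by
    intro h k hk hl
    subst hl
    rw [encL, dif_pos hk]
    rfl
  rw [key (List.ofFn g) t.1 t.2 (by simp)]
  congr 1
  funext s
  simp

lemma outProb_eq (W : X → Y → ℝ) {n M : ℕ} (enc : Fin M → ∀ t : Fin n, (Fin t → Y) → X)
    (m : Fin M) (y : Fin n → Y) :
    feedbackOutProb W enc m y = P (fun h => W (encL enc m h)) (List.ofFn y) := by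
  rw [P_ofFn, feedbackOutProb]
  refine Finset.prod_congr rfl fun t _ => ?_
  rw [encL_ofFn]

lemma code_bound (W : X → Y → ℝ) {n M : ℕ} (hM : 0 < M)
    (enc : Fin M → ∀ t : Fin n, (Fin t → Y) → X) (dec : (Fin n → Y) → Fin M)
    (Q : List Y → ℝ) (hQ : S n Q = 1) (a b : ℝ)
    (H : ∀ e : List Y → X, 1/2 ≤ S n (fun y => min (a * P (fun h => W (e h)) y) (b * Q y))) :
    1/2 ≤ a * feedbackAvgError W enc dec + b / M := by
  classical
  have hMr : (0:ℝ) < M := by exact_mod_cast hM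
  have h1 : ∀ m : Fin M, 1/2 ≤ a * (∑ y ∈ Finset.univ.filter (fun y : Fin n → Y => dec y ≠ m),
      feedbackOutProb W enc m y) + b * ∑ y : Fin n → Y, if dec y = m then Q (List.ofFn y) else 0 := by
    intro m
    refine (H (encL enc m)).trans ?_
    rw [S, Finset.sum_filter, Finset.mul_sum, Finset.mul_sum, ← Finset.sum_add_distrib]
    refine Finset.sum_le_sum fun y _ => ?_
    rw [outProb_eq]
    by_cases h : dec y = m
    · simp [h]
    · simp [h]
  have h2 := Finset.sum_le_sum (s := Finset.univ) fun m (_ : m ∈ Finset.univ) => h1 m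
  rw [Finset.sum_add_distrib, ← Finset.mul_sum, ← Finset.mul_sum] at h2
  have h3 : ∑ m : Fin M, ∑ y : Fin n → Y, (if dec y = m then Q (List.ofFn y) else 0) = 1 := by
    rw [Finset.sum_comm]
    simp only [Finset.sum_ite_eq, Finset.mem_univ, if_true]
    exact hQ
  rw [h3] at h2
  simp only [Finset.sum_const, Finset.card_univ, Fintype.card_fin, nsmul_eq_mul, mul_one] at h2
  rw [feedbackAvgError]
  have h4 : a * (1 / (M:ℝ) * ∑ m, ∑ y ∈ Finset.univ.filter (fun y : Fin n → Y => dec y ≠ m),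
      feedbackOutProb W enc m y) + b / M = (a * (∑ m, ∑ y ∈ Finset.univ.filter (fun y : Fin n → Y => dec y ≠ m),
      feedbackOutProb W enc m y) + b) / M := by field_simp
  rw [h4, le_div_iff₀ hMr]
  linarith

lemma core (W : X → Y → ℝ) (hW : ∀ x, IsPMF (W x))
    (c : ℝ) (hc0 : 0 < c) (hc1 : c ≤ 1) (hc : ∀ x y, 0 < W x y → c ≤ W x y)
    (ε : ℝ) (hε0 : 0 < ε) (hε : ε ≤ 1/2) (L : ℝ)
    (hL : L = Real.log (1/ε) + (2 * Real.log (Fintype.card Y) + 1 + Real.log (1/c)))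
    (ρ θ R E : ℝ) (hρ : 0 < ρ) (hθ : 0 < θ) (K l N r : ℕ) (hK : 0 < K)
    (hθl : θ * (l * L) ≤ 1)
    (hE : ∀ α ∈ Set.Ioo (0:ℝ) 1, ((1-α)/α) * (renyiCap α W - R) ≤ E)
    (hlast : renyiCap (1/(1+ρ)) W + 2 * ε ≤ R)
    {M : ℕ} (hM : 0 < M)
    (enc : Fin M → ∀ t : Fin (N*l+r), (Fin t → Y) → X) (dec : (Fin (N*l+r) → Y) → Fin M) :
    1/2 ≤ Real.exp (N * (l * (E + ρ * (2*ε) + ρ / K * R) + θ * (l*L)^2) + Real.log 4 / θ)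
        * feedbackAvgError W enc dec +
      Real.exp (N * (l * R + θ * (l*L)^2 + Real.log K) + Real.log 4 / θ
        + r * Real.log (Fintype.card Y)) / M := by
  have hKr : (0:ℝ) < K := by exact_mod_cast hK
  have hY : (0:ℝ) < Fintype.card Y := by exact_mod_cast Fintype.card_pos
  set Δ := ρ / K with hΔ
  have hΔ0 : 0 < Δ := by positivity
  set α : ℕ → ℝ := fun j => 1 / (1 + ((j:ℝ)+1)*Δ) with hα
  have hαm : ∀ j, α j ∈ Set.Ioo (0:ℝ) 1 := by
    intro j
    have : 0 < ((j:ℝ)+1)*Δ := by positivity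
    refine ⟨by simp only [hα]; positivity, ?_⟩
    simp only [hα]
    rw [div_lt_one (by positivity)]; linarith
  have hαρ : ∀ j, (1 - α j) / α j = ((j:ℝ)+1)*Δ := by
    intro j
    have : 0 < 1 + ((j:ℝ)+1)*Δ := by positivity
    simp only [hα]; field_simp; ring
  have hlet := fun j => letter (α j) (hαm j) W hW c hc0 hc1 hc ε hε0 hε L hL
  simp only [hαρ] at hlet
  choose q hq v hv hvb using hlet
  have hsupp : ∀ j < K, ∀ (e : List Y → X) (y : List Y), 0 < P (fun h => v j (e h)) y →
      0 < P (fun h => W (e h)) y ∧ 0 < P (fun _ => q j) y := by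
    intro j _ e y hy
    have := block_pt W (v j) (q j) L _ _ (fun x y => (hv j x).1 y) (hvb j) y e hy
    exact ⟨this.1, this.2.1⟩
  have hblock := block W hW K hK v q L Δ θ R E (ρ * (2*ε)) (fun j => renyiCap (α j) W + 2 * ε) l
    hv hq hΔ0 hθ.le hθl (fun j _ => hvb j) (by
      intro j hj
      have h1 := hE _ (hαm j)
      rw [hαρ] at h1
      have h2 : ((j:ℝ)+1)*Δ ≤ ρ := by
        rw [hΔ, mul_div_assoc', div_le_iff₀ hKr, mul_comm]
        have : (j:ℝ)+1 ≤ K := by exact_mod_cast hj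
        gcongr
      have h3 := mul_le_mul_of_nonneg_right h2 (show 0 ≤ 2 * ε by positivity)
      linarith) (by
      have : α (K-1) = 1/(1+ρ) := by
        simp only [hα]
        congr 2
        rw [Nat.cast_sub hK, hΔ]; field_simp; ring
      simp only [this]
      exact hlast)
  refine code_bound W hM enc dec (Qf K q l N) (Qf_sum K hK q l r hq N) _ _ fun e => ?_
  refine le_trans ?_ (chain W hW K hK v q θ _ _ l r hv hq hθ.le (Real.exp_pos _).le (Real.exp_pos _).le
    hsupp hblock N e _ _ (Real.exp_pos _) (Real.exp_pos _))
  have x4 : Real.exp (-Real.log 4) = 1/4 := by rw [Real.exp_neg, Real.exp_log (by norm_num)]; norm_num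
  have e1 : Real.exp (N * (l * (E + ρ * (2*ε) + Δ * R) + θ * (l*L)^2) + Real.log 4 / θ) ^ (-θ) *
      Real.exp (θ * (l * (E + ρ * (2*ε) + Δ * R)) + (θ * (l * L))^2) ^ N = 1/4 := by
    rw [← Real.exp_mul, ← Real.exp_nat_mul, ← Real.exp_add, ← x4]
    congr 1
    field_simp
    ring
  have e2 : Real.exp (N * (l * R + θ * (l*L)^2 + Real.log K) + Real.log 4 / θ
        + r * Real.log (Fintype.card Y)) ^ (-θ) * (((Fintype.card Y : ℝ) ^ r) ^ θ *
        ((K:ℝ)^θ * Real.exp (θ * (l * R) + (θ * (l * L))^2)) ^ N) = 1/4 := by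
    rw [Real.rpow_def_of_pos (show (0:ℝ) < (Fintype.card Y : ℝ)^r by positivity), Real.rpow_def_of_pos hKr,
      Real.log_pow, ← Real.exp_add, ← Real.exp_mul, ← Real.exp_nat_mul, ← Real.exp_add, ← Real.exp_add, ← x4]
    congr 1
    field_simp
    ring
  rw [e1, e2]
  norm_num

end final

section asym
variable {X Y : Type*} [Fintype X] [Fintype Y] [Nonempty X] [Nonempty Y]

lemma spe_bdd (W : X → Y → ℝ) (hW : ∀ x, IsPMF (W x)) (R : ℝ) (hR : 0 ≤ R)
    (α0 : ℝ) (h0 : 0 < α0) (hcap : ∀ α ∈ Set.Ioo 0 α0, renyiCap α W < R) :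
    BddAbove {e | ∃ α ∈ Set.Ioo (0:ℝ) 1, e = ((1 - α) / α) * (renyiCap α W - R)} := by
  have hY1 : (1:ℝ) ≤ Fintype.card Y := by exact_mod_cast Fintype.card_pos
  have hlog := Real.log_nonneg hY1
  refine ⟨Real.log (Fintype.card Y) / α0, ?_⟩
  rintro _ ⟨α, hα, rfl⟩
  have h1 : 0 < 1 - α := by linarith [hα.2]
  have hα0 := hα.1
  rcases lt_or_ge α α0 with h | h
  · have := hcap α ⟨hα.1, h⟩
    have : (1 - α) / α * (renyiCap α W - R) ≤ 0 :=
      mul_nonpos_of_nonneg_of_nonpos (by positivity) (by linarith)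
    exact this.trans (by positivity)
  · have h2 := cap_le α hα W hW
    rw [le_div_iff₀ h1] at h2
    have : (1 - α) / α * (renyiCap α W - R) ≤ Real.log (Fintype.card Y) / α := by
      rw [div_mul_eq_mul_div]
      gcongr
      nlinarith
    refine this.trans ?_
    gcongr

lemma spe_nonneg (W : X → Y → ℝ) (hW : ∀ x, IsPMF (W x)) (R : ℝ) (hR : 0 ≤ R)
    (hb : BddAbove {e | ∃ α ∈ Set.Ioo (0:ℝ) 1, e = ((1 - α) / α) * (renyiCap α W - R)}) :
    0 ≤ spe R W := by
  refine le_of_forall_pos_le_add fun η hη => ?_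
  set d := η / (R + 1) with hd
  have hd0 : 0 < d := by positivity
  have hα : 1/(1+d) ∈ Set.Ioo (0:ℝ) 1 := ⟨by positivity, by rw [div_lt_one (by positivity)]; linarith⟩
  have h1 : ((1 - 1/(1+d)) / (1/(1+d))) * (renyiCap (1/(1+d)) W - R) ≤ spe R W := le_csSup hb ⟨_, hα, rfl⟩
  have h2 : (1 - 1/(1+d)) / (1/(1+d)) = d := by field_simp; ring
  rw [h2] at h1
  have h3 := cap_nonneg _ hα W hW
  have h4 : d * R ≤ η := by
    have : d * (R+1) = η := by rw [hd]; field_simp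
    linarith
  nlinarith

/-- The elementary numerical estimate. -/
lemma numeric (t lg l N r n L E c2 κ R R' lK lY lf θ : ℝ) (ht : 100 ≤ t) (hlg : 1 ≤ lg) (hn : n = t^3)
    (hl : t ≤ l) (hl2 : l ≤ t + 1) (hN0 : 0 ≤ N) (hr0 : 0 ≤ r) (hnl : N * l + r = n) (hrl : r ≤ l)
    (hL0 : 0 ≤ L) (hL : L ≤ lg / 2) (hE : 0 ≤ E) (hR' : 0 ≤ R') (hκ : κ ≤ c2 / t) (hc20 : 0 ≤ c2) (hc2 : c2 ≤ lg / 10)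
    (hlK : lK ≤ 2 / 5 * lg) (hlK0 : 0 ≤ lK) (hlY : lY ≤ lg) (hlY0 : 0 ≤ lY) (hlf : lf = Real.log 4)
    (hθ : θ = 2 / (t^2 * lg)) (hR : R = R' + 2 * lg / t) :
    N * (l * (E + κ) + θ * (l*L)^2) + lf / θ + lf ≤ n * (E + 2 * lg / t) ∧
    N * (l * R' + θ * (l*L)^2 + lK) + lf / θ + r * lY + lf ≤ n * R := by
  have ht0 : 0 < t := by linarith
  have hlg0 : 0 < lg := by linarith
  have hlf2 : lf ≤ 1.3864 := by
    rw [hlf, show (4:ℝ) = 2^2 by norm_num, Real.log_pow]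
    have := Real.log_two_lt_d9
    push_cast; linarith
  have hlf0 : 0 ≤ lf := by rw [hlf]; exact Real.log_nonneg (by norm_num)
  have hθ0 : 0 < θ := by rw [hθ]; positivity
  have hNl : N * l ≤ n := by linarith
  have hN : N ≤ t^2 := by
    have : N * t ≤ t^2 * t := by nlinarith
    exact le_of_mul_le_mul_right this ht0
  set U := t^2 * lg with hU
  have hU0 : 0 < U := by positivity
  have hUt : 100 * t ≤ t^2 := by nlinarith
  have hU1 : t^2 ≤ U := by rw [hU]; nlinarith [sq_nonneg t]
  have hUt2 : 100 * (t * lg) ≤ U := by rw [hU]; nlinarith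
  have hU2 : 10000 ≤ U := by nlinarith
  -- quadratic term
  have q1 : N * (θ * (l*L)^2) ≤ 51/100 * U := by
    have h1 : N * (θ * (l*L)^2) = (N * l) * l * L^2 * θ := by ring
    have h2 : L^2 ≤ (lg/2)^2 := by gcongr
    have h3 : l ≤ 101/100 * t := by linarith
    have h4 : (N * l) * l * L^2 * θ ≤ t^3 * (101/100 * t) * (lg/2)^2 * θ := by
      have : 0 ≤ l := by linarith
      have : N * l ≤ t^3 := by linarith
      gcongr
    have h5 : t^3 * (101/100 * t) * (lg/2)^2 * θ = 101/200 * U := by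
      rw [hθ, hU]; field_simp; ring
    rw [h1]; linarith
  have q2 : lf / θ ≤ 7/10 * U := by
    have : lf / θ = lf / 2 * U := by rw [hθ]; field_simp
    rw [this]
    nlinarith
  have q3 : lf ≤ U / 100 := by linarith
  have q4 : n * (2 * lg / t) = 2 * U := by rw [hn, hU]; field_simp
  have q5 : N * l * κ ≤ U / 10 := by
    have h0 : 0 ≤ N * l := mul_nonneg hN0 (by linarith)
    calc N * l * κ ≤ N * l * (c2 / t) := by gcongr
      _ ≤ t^3 * ((lg/10) / t) := by
          have hn0 : 0 ≤ n := by linarith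
          rw [← hn]; gcongr
      _ = U / 10 := by rw [hU]; field_simp
  have q6 : N * l * E ≤ n * E := by gcongr
  have q7 : N * l * R' ≤ n * R' := by gcongr
  have q8 : N * lK ≤ 2/5 * U := by
    calc N * lK ≤ t^2 * (2/5*lg) := by gcongr
      _ = _ := by rw [hU]; ring
  have q9 : r * lY ≤ U / 50 := by
    calc r * lY ≤ (2 * t) * lg := by
          apply mul_le_mul _ hlY hlY0 (by positivity)
          linarith
      _ ≤ _ := by linarith
  constructor
  · linarith
  · rw [hR]; linarith

end asym

end SPF

/-- the sphere packing bound for codes on discrete stationary product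
channels with feedback. -/
theorem sphere_packing_bound_feedback {X Y : Type*} [Fintype X] [Fintype Y] [Nonempty X]
    [Nonempty Y] (W : X → Y → ℝ) (hW : ∀ x, IsPMF (W x)) (C0 : ℝ)
    (hC0 : Filter.Tendsto (fun α => renyiCap α W) (nhdsWithin 0 (Set.Ioi 0)) (nhds C0))
    (hne : C0 ≠ renyiCap 1 W) (R0 R1 : ℝ)
    (hR0 : C0 < R0) (hR01 : R0 < R1) (hR1 : R1 < renyiCap 1 W) :
    ∃ n0 : ℕ, ∀ n : ℕ, n ≥ n0 → ∀ R : ℝ,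
      R0 + 2 * Real.log n / (n : ℝ) ^ ((1:ℝ)/3) < R → R < R1 →
      ∀ (enc : Fin (Nat.ceil (Real.exp (n * R))) → ∀ t : Fin n, (Fin t → Y) → X)
        (dec : (Fin n → Y) → Fin (Nat.ceil (Real.exp (n * R)))),
        feedbackAvgError W enc dec ≥
          Real.exp (-(n : ℝ) *
            (spe (R - 2 * Real.log n / (n : ℝ) ^ ((1:ℝ)/3)) W
              + 2 * Real.log n / (n : ℝ) ^ ((1:ℝ)/3))) := by
  classical
  have hev : ∀ᶠ α in nhdsWithin (0:ℝ) (Set.Ioi 0), renyiCap α W < R0 := hC0.eventually (gt_mem_nhds hR0)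
  obtain ⟨α1, hα1, hα1c⟩ := (mem_nhdsGT_iff_exists_Ioo_subset).1 hev
  have hα1p : 0 < α1 := hα1
  have hC0n : 0 ≤ C0 := by
    refine ge_of_tendsto hC0 ?_
    filter_upwards [Ioo_mem_nhdsGT (show (0:ℝ) < 1 by norm_num)] with α hα
    exact SPF.cap_nonneg α hα W hW
  set αs := min α1 1 / 2 with hαs
  have hαs0 : 0 < αs := by positivity
  have hαs1 : αs < 1 := by
    have := min_le_right α1 1
    rw [hαs]; linarith
  have hαsc : renyiCap αs W < R0 := by
    refine hα1c ⟨hαs0, ?_⟩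
    have := min_le_left α1 1
    rw [hαs]; linarith
  set ρ := (1 - αs) / αs with hρ
  have hρ0 : 0 < ρ := div_pos (by linarith) hαs0
  have hρα : 1 / (1 + ρ) = αs := by rw [hρ]; field_simp; ring
  obtain ⟨c, hc0, hc1, hc⟩ := SPF.wmin_exists W hW
  have hY1 : (1:ℝ) ≤ Fintype.card Y := by exact_mod_cast Fintype.card_pos
  set lY := Real.log (Fintype.card Y) with hlY
  have hlY0 : 0 ≤ lY := Real.log_nonneg hY1
  set c1 := 2 * lY + 1 + Real.log (1/c) with hc1d
  have hlc : 0 ≤ Real.log (1/c) := Real.log_nonneg (by rw [le_div_iff₀ hc0]; linarith)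
  set c2 := ρ * (2 + R1) with hc2d
  have hR1n : 0 ≤ R1 := by linarith
  have hc20 : 0 ≤ c2 := by positivity
  set g := R0 - renyiCap αs W with hg
  have hg0 : 0 < g := by linarith
  have T1 : Filter.Tendsto (fun n : ℕ => (n:ℝ) ^ ((1:ℝ)/3)) Filter.atTop Filter.atTop :=
    (tendsto_rpow_atTop (by norm_num)).comp tendsto_natCast_atTop_atTop
  have T2 : Filter.Tendsto (fun n : ℕ => Real.log (n:ℝ)) Filter.atTop Filter.atTop :=
    Real.tendsto_log_atTop.comp tendsto_natCast_atTop_atTop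
  have hfin := ((T1.eventually_ge_atTop 100).and (T1.eventually_ge_atTop (2/g))).and
    ((T2.eventually_ge_atTop (6 * c1)).and ((T2.eventually_ge_atTop (10 * c2)).and
      ((T2.eventually_ge_atTop (lY + 100)))))
  obtain ⟨n0, hn0⟩ := Filter.eventually_atTop.1 hfin
  refine ⟨n0, fun n hn R hRl hRu => ?_⟩
  obtain ⟨⟨ht, htg⟩, hl1, hl2, hl3⟩ := hn0 n hn
  set t := (n:ℝ) ^ ((1:ℝ)/3) with htd
  set lg := Real.log (n:ℝ) with hlgd
  have ht0 : 0 < t := by linarith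
  have hn3 : (n:ℝ) = t^3 := by
    rw [htd, ← Real.rpow_natCast, ← Real.rpow_mul (by positivity)]; norm_num
  have hlt : lg = 3 * Real.log t := by rw [hlgd, hn3, Real.log_pow]; norm_num
  have hlg0 : 0 < lg := by linarith
  set R' := R - 2 * lg / t with hR'
  have hR'0 : R0 < R' := by linarith
  have hdel : 0 < 2 * lg / t := by positivity
  have hbdd := SPF.spe_bdd W hW R' (by linarith) α1 hα1p (fun α hα => (hα1c hα).trans hR'0)
  have hE0 := SPF.spe_nonneg W hW R' (by linarith) hbdd
  set l := ⌈t⌉₊ with hl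
  have hlt1 : t ≤ l := Nat.le_ceil t
  have hlt2 : (l:ℝ) ≤ t + 1 := (Nat.ceil_lt_add_one ht0.le).le
  have hl0 : 0 < l := Nat.ceil_pos.2 ht0
  have hdm : n / l * l + n % l = n := by rw [mul_comm]; exact Nat.div_add_mod n l
  have hdmr : ((n / l : ℕ):ℝ) * l + ((n % l : ℕ):ℝ) = n := by exact_mod_cast hdm
  have hrl : ((n % l : ℕ):ℝ) ≤ l := by exact_mod_cast (Nat.mod_lt n hl0).le
  set M := Nat.ceil (Real.exp (n * R)) with hM
  have hM0 : 0 < M := Nat.ceil_pos.2 (Real.exp_pos _)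
  have hMe : Real.exp (n * R) ≤ M := Nat.le_ceil _
  set L := Real.log (1/(1/t)) + c1 with hL
  have hLt : L = lg / 3 + c1 := by rw [hL, one_div_one_div, hlt]; ring
  set θ := 2 / (t^2 * lg) with hθ
  have hθ0 : 0 < θ := by positivity
  have hL0 : 0 ≤ L := by rw [hLt]; positivity
  have hL2 : L ≤ lg / 2 := by rw [hLt]; linarith
  have hθl : θ * (l * L) ≤ 1 := by
    have h1 : (l:ℝ) * L ≤ (2 * t) * (lg / 2) := by
      apply mul_le_mul _ hL2 hL0 (by positivity)
      linarith
    calc θ * (l * L) ≤ θ * ((2 * t) * (lg/2)) := by gcongr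
      _ = 2 / t := by rw [hθ]; field_simp
      _ ≤ 1 := by rw [div_le_one ht0]; linarith
  have hlK : Real.log l ≤ 2/5 * lg := by
    have h1 : Real.log l ≤ Real.log (2 * t) := Real.log_le_log (by positivity) (by linarith)
    rw [Real.log_mul (by norm_num) ht0.ne'] at h1
    have := Real.log_two_lt_d9
    linarith
  have hκ : ρ * (2 * (1/t)) + ρ / l * R' ≤ c2 / t := by
    have h1 : ρ / l * R' ≤ ρ / t * R1 := by
      have : R' ≤ R1 := by linarith
      have : 0 ≤ R' := by linarith
      gcongr
    have : c2 / t = ρ * (2 * (1/t)) + ρ / t * R1 := by rw [hc2d]; field_simp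
    linarith
  have hnum := SPF.numeric t lg l ((n / l : ℕ):ℝ) ((n % l : ℕ):ℝ) n L (spe R' W) c2
    (ρ * (2 * (1/t)) + ρ / l * R') R R' (Real.log l) lY (Real.log 4) θ ht (by linarith) hn3 hlt1 hlt2
    (by positivity) (by positivity) hdmr hrl hL0 hL2 hE0 (by linarith) hκ hc20 (by linarith) hlK
    (Real.log_nonneg (by linarith)) (by linarith) hlY0 rfl hθ (by rw [hR']; ring)
  have hlast : renyiCap (1/(1+ρ)) W + 2 * (1/t) ≤ R' := by
    rw [hρα]
    have : 2 / t ≤ g := by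
      rw [div_le_iff₀ ht0]
      rw [div_le_iff₀ hg0] at htg
      linarith
    have e : 2 * (1/t) = 2 / t := by ring
    rw [e]; linarith
  have hcore : ∀ (n' : ℕ), n' = n / l * l + n % l → ∀ (enc : Fin M → ∀ t : Fin n', (Fin t → Y) → X)
      (dec : (Fin n' → Y) → Fin M), 1/2 ≤ Real.exp (((n / l : ℕ):ℝ) * (l * (spe R' W + ρ * (2*(1/t)) + ρ / l * R') + θ * (l*L)^2) + Real.log 4 / θ)
        * feedbackAvgError W enc dec +
      Real.exp (((n / l : ℕ):ℝ) * (l * R' + θ * (l*L)^2 + Real.log l) + Real.log 4 / θ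
        + ((n % l : ℕ):ℝ) * Real.log (Fintype.card Y)) / M := by
    intro n' hn' enc dec
    subst hn'
    exact SPF.core W hW c hc0 hc1 hc (1/t) (by positivity)
      (by rw [div_le_div_iff₀ ht0 (by norm_num)]; linarith) L (by rw [hL]) ρ θ R' (spe R' W) hρ0 hθ0
      l l (n / l) (n % l) hl0 hθl (fun α hα => le_csSup hbdd ⟨α, hα, rfl⟩) hlast hM0 enc dec
  intro enc dec
  have hc := hcore n hdm.symm enc dec
  obtain ⟨hn1, hn2⟩ := hnum
  have x4 : Real.exp (-Real.log 4) = 1/4 := by rw [Real.exp_neg, Real.exp_log (by norm_num)]; norm_num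
  set a0 := ((n / l : ℕ):ℝ) * (l * (spe R' W + ρ * (2*(1/t)) + ρ / l * R') + θ * (l*L)^2) + Real.log 4 / θ with ha0
  set b0 := ((n / l : ℕ):ℝ) * (l * R' + θ * (l*L)^2 + Real.log l) + Real.log 4 / θ
        + ((n % l : ℕ):ℝ) * Real.log (Fintype.card Y) with hb0
  have hMr : (0:ℝ) < M := by exact_mod_cast hM0
  have hb : Real.exp b0 / M ≤ 1/4 := by
    rw [div_le_iff₀ hMr]
    calc Real.exp b0 ≤ Real.exp (-Real.log 4 + n * R) := Real.exp_le_exp.2 (by linarith)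
      _ = 1/4 * Real.exp (n * R) := by rw [Real.exp_add, x4]
      _ ≤ _ := by gcongr
  have ha : 1/4 ≤ Real.exp a0 * feedbackAvgError W enc dec := by linarith
  have ha' : a0 + Real.log 4 ≤ n * (spe R' W + 2 * lg / t) := by
    rw [ha0]
    refine le_trans (le_of_eq ?_) hn1
    ring
  calc Real.exp (-(n:ℝ) * (spe R' W + 2 * lg / t)) ≤ Real.exp (-Real.log 4 + -a0) :=
        Real.exp_le_exp.2 (by linarith)
    _ = 1/4 * Real.exp (-a0) := by rw [Real.exp_add, x4]
    _ ≤ (Real.exp a0 * feedbackAvgError W enc dec) * Real.exp (-a0) := by gcongr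
    _ = feedbackAvgError W enc dec := by
        rw [mul_right_comm, ← Real.exp_add]; simp
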